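/- Let m : ℕ → ℕ and suppose 2·m(n)/n → c for some constant c ∈ (1, 2). If l₀ : ℕ → ℝ is such that for every sufficiently large n, l₀(n) solves the excess equation for (n, m(n)), then there exist constants c₁, c₂ > 0 such that for all sufficiently large n: c₁·n^{1/3} ≤ l₀(n) ≤ c₂·n^{1/3}. -/

import Mathlib

open Filter

/-- The constant γ = 79^(3/4)/54^(1/2). -/
noncomputable def gammaK : ℝ := (79 : ℝ) ^ ((3 : ℝ) / 4) / (54 : ℝ) ^ ((1 : ℝ) / 2)

/-- The constant φ = 2·√e·γ²·3^(−3/2). -/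
noncomputable def phiC : ℝ := 2 * Real.sqrt (Real.exp 1) * gammaK ^ 2 * (3 : ℝ) ^ (-(3 : ℝ) / 2)

/-- `l₀` solves the excess equation for `(n, m)`: it lies strictly between
`max 0 (m − n)` and `m − n/2` and satisfies
`l₀ · e^(1/3) · 2^(4/3) · (n − m + l₀)^(2/3) = φ^(2/3) · (2m − n − 2l₀)`. -/
def SolvesExcessEq (n m l₀ : ℝ) : Prop :=
  max 0 (m - n) < l₀ ∧ l₀ < m - n / 2 ∧
    l₀ * Real.exp 1 ^ ((1 : ℝ) / 3) * (2 : ℝ) ^ ((4 : ℝ) / 3) * (n - m + l₀) ^ ((2 : ℝ) / 3)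
      = phiC ^ ((2 : ℝ) / 3) * (2 * m - n - 2 * l₀)

theorem stmt6 (m : ℕ → ℕ) (l₀ : ℕ → ℝ) (c : ℝ) (hc1 : 1 < c) (hc2 : c < 2)
    (hm : Tendsto (fun n : ℕ => 2 * (m n : ℝ) / n) atTop (nhds c))
    (hl : ∀ᶠ n : ℕ in atTop, SolvesExcessEq n (m n) (l₀ n)) :
    ∃ c₁ c₂ : ℝ, 0 < c₁ ∧ 0 < c₂ ∧ ∀ᶠ n : ℕ in atTop,
      c₁ * (n : ℝ) ^ ((1 : ℝ) / 3) ≤ l₀ n ∧ l₀ n ≤ c₂ * (n : ℝ) ^ ((1 : ℝ) / 3) := by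
  have hg : 0 < gammaK := by unfold gammaK; positivity
  have hphi : 0 < phiC := by unfold phiC; positivity
  obtain ⟨A, hA⟩ : ∃ A : ℝ, A = Real.exp 1 ^ ((1 : ℝ) / 3) * (2 : ℝ) ^ ((4 : ℝ) / 3) := ⟨_, rfl⟩
  obtain ⟨B, hB⟩ : ∃ B : ℝ, B = phiC ^ ((2 : ℝ) / 3) := ⟨_, rfl⟩
  have hA0 : 0 < A := by rw [hA]; positivity
  have hB0 : 0 < B := by rw [hB]; positivity
  obtain ⟨b, hb⟩ : ∃ b : ℝ, b = (2 - c) / 4 := ⟨_, rfl⟩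
  have hb0 : 0 < b := by rw [hb]; linarith
  obtain ⟨D, hD⟩ : ∃ D : ℝ, D = b ^ ((2 : ℝ) / 3) := ⟨_, rfl⟩
  have hD0 : 0 < D := by rw [hD]; positivity
  obtain ⟨a, ha⟩ : ∃ a : ℝ, a = (c - 1) / 2 := ⟨_, rfl⟩
  have ha0 : 0 < a := by rw [ha]; linarith
  refine ⟨B * a / (A + 2 * B), B / (A * D), by positivity, by positivity, ?_⟩
  filter_upwards [hl, hm.eventually_const_lt (show (1 + c) / 2 < c by linarith),
    hm.eventually_lt_const (show c < (2 + c) / 2 by linarith), eventually_ge_atTop 1]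
    with n hn h1 h2 hn1
  obtain ⟨hl1, hl2, heq⟩ := hn
  have hN : (1 : ℝ) ≤ n := by exact_mod_cast hn1
  have hN0 : (0 : ℝ) < n := by linarith
  rw [lt_div_iff₀ hN0] at h1
  rw [div_lt_iff₀ hN0] at h2
  have hl0 : 0 < l₀ n := lt_of_le_of_lt (le_max_left _ _) hl1
  obtain ⟨x, hx⟩ : ∃ x : ℝ, x = (n : ℝ) ^ ((1 : ℝ) / 3) := ⟨_, rfl⟩
  have hx1 : 1 ≤ x := by rw [hx]; exact Real.one_le_rpow hN (by norm_num)
  have hx3 : (n : ℝ) = x ^ 3 := by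
    rw [hx, ← Real.rpow_natCast, ← Real.rpow_mul hN0.le]; norm_num
  have hx2 : (n : ℝ) ^ ((2 : ℝ) / 3) = x ^ 2 := by
    rw [hx, ← Real.rpow_natCast, ← Real.rpow_mul hN0.le]; norm_num
  have hmul : l₀ n * A * ((n : ℝ) - m n + l₀ n) ^ ((2 : ℝ) / 3)
      = B * (2 * m n - n - 2 * l₀ n) := by
    rw [hA, hB, ← heq]; ring
  have hlow : D * x ^ 2 ≤ ((n : ℝ) - m n + l₀ n) ^ ((2 : ℝ) / 3) := by
    rw [hD, ← hx2, ← Real.mul_rpow hb0.le hN0.le]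
    apply Real.rpow_le_rpow (by positivity) _ (by norm_num)
    rw [hb]; linarith
  have hbn : 0 < b * n := by positivity
  have hup : ((n : ℝ) - m n + l₀ n) ^ ((2 : ℝ) / 3) ≤ x ^ 2 := by
    rw [← hx2]
    apply Real.rpow_le_rpow _ _ (by norm_num)
    · rw [hb] at hbn; linarith
    · linarith
  have hlA : 0 < l₀ n * A := by positivity
  have e1 := mul_le_mul_of_nonneg_left hlow hlA.le
  have e2 := mul_le_mul_of_nonneg_left hup hlA.le
  rw [hmul] at e1 e2
  have hx20 : 0 < x ^ 2 := by positivity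
  have f1 : B * (2 * m n - n - 2 * l₀ n) ≤ B * x ^ 3 := by
    apply mul_le_mul_of_nonneg_left _ hB0.le
    rw [← hx3]; rw [hb] at hbn; linarith
  have f2 : B * (a * x ^ 3 - 2 * l₀ n) ≤ B * (2 * m n - n - 2 * l₀ n) := by
    apply mul_le_mul_of_nonneg_left _ hB0.le
    rw [← hx3, ha]; linarith
  rw [← hx]
  constructor
  · rw [div_mul_eq_mul_div, div_le_iff₀ (by positivity)]
    have : B * l₀ n * 1 ≤ B * l₀ n * x ^ 2 :=
      mul_le_mul_of_nonneg_left (by nlinarith) (by positivity)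
    refine le_of_mul_le_mul_right ?_ hx20
    linarith
  · rw [div_mul_eq_mul_div, le_div_iff₀ (by positivity)]
    refine le_of_mul_le_mul_right ?_ hx20
    linarith
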